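/- arXiv:1507.05356 — 2 statements merged into one kernel-verified Lean document; each statement's English description precedes it below -/
import Mathlib

section
/- For all integers n ≥ 4, ∑_{j=2}^{n-2} B_j B_{n-j}/(j(n-j)) - ∑_{j=2}^{n-2} C(n,j) B_j B_{n-j}/(j(n-j)) = 2 H_n B_n / n, where H_n = ∑_{k=1}^{n} 1/k is the n-th harmonic number (Miki's identity). -/
namespace Miki

open Polynomial Finset

/-- The divided Bernoulli polynomial (zero at index zero). -/
noncomputable def bt (k : ℕ) : ℚ[X] := C ((k : ℚ)⁻¹) * Polynomial.bernoulli k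

noncomputable def S (n : ℕ) : ℚ[X] := ∑ p ∈ antidiagonal n, bt p.1 * bt p.2

noncomputable def U (n : ℕ) : ℚ[X] :=
  ∑ p ∈ antidiagonal n,
    C ((n.choose p.1 : ℚ) * (_root_.bernoulli p.2 * (p.2 : ℚ)⁻¹)) * Polynomial.bernoulli p.1

noncomputable def T (n : ℕ) : ℚ[X] :=
  2 * (U n + C (harmonic (n - 1)) * Polynomial.bernoulli n) + derivative (Polynomial.bernoulli n)

noncomputable def Q (n : ℕ) : ℚ[X] := C (n : ℚ) * S n - T n

lemma bt_zero : bt 0 = 0 := by simp [bt]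

lemma deriv_bt_succ (k : ℕ) : derivative (bt (k + 1)) = Polynomial.bernoulli k := by
  have h : ((k : ℚ) + 1) ≠ 0 := by positivity
  have h2 : ((k : ℚ[X]) + 1) = C ((k : ℚ) + 1) := by simp
  rw [bt, derivative_mul, derivative_C, Polynomial.derivative_bernoulli_add_one, h2]
  rw [zero_mul, zero_add, ← mul_assoc, ← C_mul]
  push_cast
  rw [inv_mul_cancel₀ h]; simp

lemma mul_bt (k : ℕ) : C (k : ℚ) * bt k = Polynomial.bernoulli k - if k = 0 then 1 else 0 := by
  rcases k with _ | k
  · simp [bt]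
  · have h : ((k + 1 : ℕ) : ℚ) ≠ 0 := by positivity
    rw [bt, ← mul_assoc, ← C_mul, mul_inv_cancel₀ h]; simp

lemma sum_swap {M : Type*} [AddCommMonoid M] (n : ℕ) (f : ℕ → ℕ → M) :
    ∑ p ∈ antidiagonal n, f p.1 p.2 = ∑ p ∈ antidiagonal n, f p.2 p.1 :=
  (Finset.Nat.sum_antidiagonal_swap (f := fun p : ℕ × ℕ => f p.2 p.1) (n := n))

lemma mul_S (n : ℕ) : C (n : ℚ) * S n =
    2 * ∑ p ∈ antidiagonal n, Polynomial.bernoulli p.1 * bt p.2 - 2 * bt n := by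
  have h1 : C (n : ℚ) * S n = ∑ p ∈ antidiagonal n, (C (p.1 : ℚ) * bt p.1) * bt p.2
      + ∑ p ∈ antidiagonal n, (C (p.2 : ℚ) * bt p.2) * bt p.1 := by
    rw [S, mul_sum, ← sum_add_distrib]
    refine sum_congr rfl fun p hp => ?_
    rw [← mem_antidiagonal.1 hp]; push_cast; rw [C_add]; ring
  have h2 : ∑ p ∈ antidiagonal n, (C (p.1 : ℚ) * bt p.1) * bt p.2
      = ∑ p ∈ antidiagonal n, Polynomial.bernoulli p.1 * bt p.2 - bt n := by
    simp_rw [mul_bt, sub_mul, sum_sub_distrib]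
    congr 1
    rcases n with _ | n
    · simp
    · rw [Finset.Nat.sum_antidiagonal_succ]; simp
  rw [h1, ← sum_swap n (fun i j => (C (i : ℚ) * bt i) * bt j), h2]; ring

lemma deriv_S (n : ℕ) : derivative (S (n + 1)) = C (n : ℚ) * S n + 2 * bt n := by
  rw [mul_S, S, derivative_sum]
  simp_rw [derivative_mul, sum_add_distrib]
  have h : ∑ p ∈ antidiagonal (n + 1), bt p.1 * derivative (bt p.2)
      = ∑ p ∈ antidiagonal (n + 1), derivative (bt p.1) * bt p.2 := by
    rw [sum_swap (n + 1) (fun i j => bt i * derivative (bt j))]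
    exact sum_congr rfl fun p _ => mul_comm _ _
  rw [h, Finset.Nat.sum_antidiagonal_succ]
  simp only [deriv_bt_succ, bt_zero, derivative_zero]
  ring

lemma deriv_U (n : ℕ) : derivative (U (n + 1)) = C ((n : ℚ) + 1) * U n := by
  rw [U, derivative_sum, Finset.Nat.sum_antidiagonal_succ, U, mul_sum]
  simp only [derivative_mul, derivative_C, zero_mul, zero_add, Polynomial.bernoulli_zero,
    derivative_one, mul_zero]
  refine sum_congr rfl fun p _ => ?_
  rw [Polynomial.derivative_bernoulli_add_one]
  have h2 : ((p.1 : ℚ[X]) + 1) = C ((p.1 : ℚ) + 1) := by simp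
  rw [h2, ← mul_assoc, ← mul_assoc (C ((n : ℚ) + 1)), ← C_mul, ← C_mul]
  congr 2
  have := Nat.add_one_mul_choose_eq n p.1
  have h3 : ((n : ℚ) + 1) * (n.choose p.1 : ℚ) = ((n + 1).choose (p.1 + 1) : ℚ) * (p.1 + 1) := by
    exact_mod_cast this
  rw [← mul_assoc ((n : ℚ) + 1), h3]; ring

lemma deriv_T (n : ℕ) (hn : 1 ≤ n) :
    derivative (T (n + 1)) = C ((n : ℚ) + 1) * (T n + 2 * bt n) := by
  obtain ⟨m, rfl⟩ : ∃ m, n = m + 1 := ⟨n - 1, by omega⟩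
  have h2 (k : ℕ) : ((k : ℚ[X]) + 1) = C ((k : ℚ) + 1) := by simp
  have h3 : derivative (2 : ℚ[X]) = 0 := by simpa using derivative_natCast (R := ℚ) 2
  rw [T, T, bt]
  simp only [derivative_add, derivative_mul, derivative_C, deriv_U, h3,
    Polynomial.derivative_bernoulli_add_one, Nat.add_sub_cancel, harmonic_succ, C_add,
    ← C_eq_natCast, derivative_one, map_one]
  push_cast
  simp only [derivative_mul, derivative_add, derivative_natCast, derivative_one,
    Polynomial.derivative_bernoulli_add_one, C_add, map_natCast, map_one]
  ring

lemma deriv_Q (n : ℕ) (hn : 1 ≤ n) : derivative (Q (n + 1)) = C ((n : ℚ) + 1) * Q n := by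
  rw [Q, derivative_sub, deriv_T n hn, derivative_mul, derivative_C, deriv_S, Q]
  push_cast
  ring

lemma eval_one (k : ℕ) : (Polynomial.bernoulli k).eval 1
    = _root_.bernoulli k + if k = 1 then 1 else 0 := by
  rw [Polynomial.bernoulli_eval_one]
  split_ifs with h
  · subst h; norm_num
  · rw [bernoulli_eq_bernoulli'_of_ne_one h, add_zero]

lemma bt_eval_zero (k : ℕ) : (bt k).eval 0 = (k : ℚ)⁻¹ * _root_.bernoulli k := by
  simp [bt, Polynomial.bernoulli_eval_zero]

lemma bt_eval_one (k : ℕ) : (bt k).eval 1 = (bt k).eval 0 + if k = 1 then 1 else 0 := by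
  rw [bt_eval_zero, bt, eval_mul, eval_C, eval_one, mul_add]
  split_ifs with h
  · subst h; simp
  · simp

lemma sum_delta (m : ℕ) (f : ℕ → ℚ) :
    ∑ p ∈ antidiagonal (m + 1), (if p.1 = 1 then 1 else 0) * f p.2 = f m := by
  rw [Finset.Nat.sum_antidiagonal_succ]
  rcases m with _ | m
  · simp
  · rw [Finset.Nat.sum_antidiagonal_succ]; simp

lemma S_diff (m : ℕ) : (S (m + 3)).eval 1 - (S (m + 3)).eval 0 = 2 * (bt (m + 2)).eval 0 := by
  simp only [S, eval_finsetSum, eval_mul, bt_eval_one]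
  have e : ∀ p : ℕ × ℕ, ((bt p.1).eval 0 + if p.1 = 1 then (1 : ℚ) else 0) *
      ((bt p.2).eval 0 + if p.2 = 1 then 1 else 0) = (bt p.1).eval 0 * (bt p.2).eval 0
      + (if p.1 = 1 then 1 else 0) * ((bt p.2).eval 0 + if p.2 = 1 then 1 else 0)
      + (if p.2 = 1 then 1 else 0) * (bt p.1).eval 0 := fun p => by ring
  simp only [e, sum_add_distrib]
  rw [sum_delta (m + 2) (fun j => (bt j).eval 0 + if j = 1 then 1 else 0),
    ← sum_swap (m + 3) (fun i j => (if i = 1 then (1 : ℚ) else 0) * (bt j).eval 0),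
    sum_delta (m + 2) (fun j => (bt j).eval 0)]
  simp; ring

lemma U_diff (m : ℕ) : (U (m + 3)).eval 1 - (U (m + 3)).eval 0
    = (m + 3) * (bt (m + 2)).eval 0 := by
  simp only [U, eval_finsetSum, eval_mul, eval_C, eval_one, Polynomial.bernoulli_eval_zero]
  simp only [mul_add, sum_add_distrib, add_sub_cancel_left]
  have : ∀ p ∈ antidiagonal (m + 3), ((m + 3).choose p.1 : ℚ) *
      (_root_.bernoulli p.2 * (p.2 : ℚ)⁻¹) * (if p.1 = 1 then 1 else 0)
      = (if p.1 = 1 then 1 else 0) * ((m + 3) * (_root_.bernoulli p.2 * (p.2 : ℚ)⁻¹)) := by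
    intro p _
    split_ifs with h
    · rw [h]; simp
    · simp
  rw [sum_congr rfl this,
    sum_delta (m + 2) (fun j => ((m : ℚ) + 3) * (_root_.bernoulli j * (j : ℚ)⁻¹)), bt_eval_zero]
  ring

lemma T_diff (m : ℕ) : (T (m + 3)).eval 1 - (T (m + 3)).eval 0
    = 2 * (m + 3) * (bt (m + 2)).eval 0 := by
  have h := U_diff m
  have h2 : (2 : ℚ[X]) = C 2 := rfl
  simp only [T, h2, eval_add, eval_mul, eval_C, Polynomial.derivative_bernoulli, eval_one,
    Polynomial.bernoulli_eval_zero, eval_natCast]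
  simp
  linarith

lemma Q_diff (m : ℕ) : (Q (m + 3)).eval 1 - (Q (m + 3)).eval 0 = 0 := by
  have h1 := S_diff m
  have h2 := T_diff m
  simp only [Q, eval_sub, eval_mul, eval_C]
  push_cast
  linear_combination ((m : ℚ) + 3) * h1 - h2

lemma Q_one : Q 1 = 0 := by
  simp [Q, S, T, U, Finset.Nat.sum_antidiagonal_succ, bt]
  rw [show (2 : ℚ[X]) = C 2 from rfl, ← C_mul, ← C_neg, ← C_1, ← C_neg, ← C_add]
  norm_num

lemma Q_eq_zero (n : ℕ) : Q (n + 1) = 0 := by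
  induction n with
  | zero => exact Q_one
  | succ n ih =>
    have h1 : derivative (Q (n + 2)) = 0 := by
      rw [deriv_Q (n + 1) (by omega), ih, mul_zero]
    obtain ⟨c, hc⟩ : ∃ c, Q (n + 2) = C c := ⟨_, eq_C_of_derivative_eq_zero h1⟩
    have h2 := deriv_Q (n + 2) (by omega)
    rw [hc] at h2
    have h3 : derivative (Q (n + 3) - C ((((n + 2 : ℕ) : ℚ) + 1) * c) * X) = 0 := by
      rw [derivative_sub, h2]; simp
    have h4 := eq_C_of_derivative_eq_zero h3
    have h5 := Q_diff n
    rw [sub_eq_iff_eq_add.1 h4] at h5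
    simp at h5
    have h6 : ((n : ℚ) + 2 + 1) ≠ 0 := by positivity
    rw [show n + 1 + 1 = n + 2 from rfl, hc, h5.resolve_left h6]; simp

/-- The identity at zero. -/
lemma at_zero (n : ℕ) (hn : 1 ≤ n) :
    (n : ℚ) * ∑ p ∈ antidiagonal n,
      ((p.1 : ℚ)⁻¹ * _root_.bernoulli p.1) * ((p.2 : ℚ)⁻¹ * _root_.bernoulli p.2)
    = 2 * (∑ p ∈ antidiagonal n, ((n.choose p.1 : ℚ) * (_root_.bernoulli p.2 * (p.2 : ℚ)⁻¹))
        * _root_.bernoulli p.1 + harmonic (n - 1) * _root_.bernoulli n)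
      + n * _root_.bernoulli (n - 1) := by
  obtain ⟨m, rfl⟩ : ∃ m, n = m + 1 := ⟨n - 1, by omega⟩
  have h := congrArg (eval 0) (Q_eq_zero m)
  have h2 : (2 : ℚ[X]) = C 2 := rfl
  simp only [Q, T, S, U, h2, eval_sub, eval_mul, eval_C, eval_add, eval_finsetSum, bt_eval_zero,
    Polynomial.derivative_bernoulli, Polynomial.bernoulli_eval_zero, eval_natCast, eval_zero] at h
  linarith

lemma V_eq (n : ℕ) (hn : 1 ≤ n) :
    (n : ℚ) * ∑ p ∈ antidiagonal n, (n.choose p.1 : ℚ) *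
      (((p.1 : ℚ)⁻¹ * _root_.bernoulli p.1) * ((p.2 : ℚ)⁻¹ * _root_.bernoulli p.2))
    = 2 * (∑ p ∈ antidiagonal n, ((n.choose p.1 : ℚ) * (_root_.bernoulli p.2 * (p.2 : ℚ)⁻¹))
        * _root_.bernoulli p.1 - _root_.bernoulli n * (n : ℚ)⁻¹) := by
  have h1 : (n : ℚ) * ∑ p ∈ antidiagonal n, (n.choose p.1 : ℚ) *
      (((p.1 : ℚ)⁻¹ * _root_.bernoulli p.1) * ((p.2 : ℚ)⁻¹ * _root_.bernoulli p.2))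
      = ∑ p ∈ antidiagonal n, (n.choose p.1 : ℚ) * ((p.1 : ℚ) *
      (((p.1 : ℚ)⁻¹ * _root_.bernoulli p.1) * ((p.2 : ℚ)⁻¹ * _root_.bernoulli p.2)))
      + ∑ p ∈ antidiagonal n, (n.choose p.2 : ℚ) * ((p.2 : ℚ) *
      (((p.2 : ℚ)⁻¹ * _root_.bernoulli p.2) * ((p.1 : ℚ)⁻¹ * _root_.bernoulli p.1))) := by
    rw [mul_sum, ← sum_add_distrib]
    refine sum_congr rfl fun p hp => ?_
    have hp' := mem_antidiagonal.1 hp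
    rw [← Nat.choose_symm_of_eq_add (n := n) (a := p.1) (b := p.2) hp'.symm]
    have : (n : ℚ) = p.1 + p.2 := by exact_mod_cast hp'.symm
    rw [this]; ring
  rw [h1, ← sum_swap n (fun i j => (n.choose i : ℚ) * ((i : ℚ) *
      (((i : ℚ)⁻¹ * _root_.bernoulli i) * ((j : ℚ)⁻¹ * _root_.bernoulli j)))), ← two_mul]
  congr 1
  obtain ⟨m, rfl⟩ : ∃ m, n = m + 1 := ⟨n - 1, by omega⟩
  rw [Finset.Nat.sum_antidiagonal_succ, Finset.Nat.sum_antidiagonal_succ]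
  simp only [Nat.choose_zero_right, _root_.bernoulli_zero, Nat.cast_zero, Nat.cast_one]
  rw [zero_mul, mul_zero, zero_add, one_mul, mul_one, add_sub_cancel_left]
  refine sum_congr rfl fun p _ => ?_
  have : ((p.1 + 1 : ℕ) : ℚ) ≠ 0 := by positivity
  field_simp

/-- Splitting off the ends of an antidiagonal sum. -/
lemma split_sum (m : ℕ) (f : ℕ → ℕ → ℚ) :
    ∑ p ∈ antidiagonal (m + 4), f p.1 p.2 =
      f 0 (m + 4) + f 1 (m + 3) + ∑ j ∈ Icc 2 (m + 2), f j (m + 4 - j)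
        + f (m + 3) 1 + f (m + 4) 0 := by
  rw [Finset.Nat.sum_antidiagonal_eq_sum_range_succ f, sum_range_succ, sum_range_succ,
    sum_range_succ', sum_range_succ']
  have : Icc 2 (m + 2) = Ico 2 (m + 3) := by ext; simp; omega
  rw [this, sum_Ico_eq_sum_range]
  have e : ∀ j, f (2 + j) (m + 4 - (2 + j)) = f (j + 1 + 1) (m + 4 - (j + 1 + 1)) := fun j => by
    rw [show 2 + j = j + 1 + 1 by ring]
  simp only [e]
  simp
  ring

end Miki

theorem miki_identity (n : ℕ) (hn : 4 ≤ n) :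
    ∑ j ∈ Finset.Icc 2 (n - 2), bernoulli j * bernoulli (n - j) / ((j : ℚ) * ((n : ℚ) - j))
      - ∑ j ∈ Finset.Icc 2 (n - 2),
          (n.choose j : ℚ) * bernoulli j * bernoulli (n - j) / ((j : ℚ) * ((n : ℚ) - j))
      = 2 * harmonic n * bernoulli n / n := by
  obtain ⟨m, rfl⟩ : ∃ m, n = m + 4 := ⟨n - 4, by omega⟩
  have hA := Miki.at_zero (m + 4) (by omega)
  have hV := Miki.V_eq (m + 4) (by omega)
  rw [Miki.split_sum m (fun i j => ((i : ℚ)⁻¹ * bernoulli i) * ((j : ℚ)⁻¹ * bernoulli j))] at hA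
  rw [Miki.split_sum m (fun i j => ((m + 4).choose i : ℚ) *
    (((i : ℚ)⁻¹ * bernoulli i) * ((j : ℚ)⁻¹ * bernoulli j)))] at hV
  have e1 : ∑ j ∈ Finset.Icc 2 (m + 4 - 2),
      bernoulli j * bernoulli (m + 4 - j) / ((j : ℚ) * (((m + 4 : ℕ) : ℚ) - j))
      = ∑ j ∈ Finset.Icc 2 (m + 2),
        ((j : ℚ)⁻¹ * bernoulli j) * (((m + 4 - j : ℕ) : ℚ)⁻¹ * bernoulli (m + 4 - j)) := by
    refine Finset.sum_congr rfl fun j hj => ?_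
    have hj' := Finset.mem_Icc.1 hj
    rw [Nat.cast_sub (by omega), div_eq_mul_inv, mul_inv]; ring
  have e2 : ∑ j ∈ Finset.Icc 2 (m + 4 - 2), ((m + 4).choose j : ℚ) *
      bernoulli j * bernoulli (m + 4 - j) / ((j : ℚ) * (((m + 4 : ℕ) : ℚ) - j))
      = ∑ j ∈ Finset.Icc 2 (m + 2), ((m + 4).choose j : ℚ) *
        (((j : ℚ)⁻¹ * bernoulli j) * (((m + 4 - j : ℕ) : ℚ)⁻¹ * bernoulli (m + 4 - j))) := by
    refine Finset.sum_congr rfl fun j hj => ?_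
    have hj' := Finset.mem_Icc.1 hj
    rw [Nat.cast_sub (by omega), div_eq_mul_inv, mul_inv]; ring
  rw [e1, e2]
  generalize (∑ j ∈ Finset.Icc 2 (m + 2), ((m + 4).choose j : ℚ) *
        (((j : ℚ)⁻¹ * bernoulli j) * (((m + 4 - j : ℕ) : ℚ)⁻¹ * bernoulli (m + 4 - j)))) = V at *
  generalize (∑ j ∈ Finset.Icc 2 (m + 2),
        ((j : ℚ)⁻¹ * bernoulli j) * (((m + 4 - j : ℕ) : ℚ)⁻¹ * bernoulli (m + 4 - j))) = A at *
  generalize (∑ p ∈ Finset.HasAntidiagonal.antidiagonal (m + 4), (((m + 4).choose p.1 : ℚ) *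
    (bernoulli p.2 * (p.2 : ℚ)⁻¹)) * bernoulli p.1) = W at *
  have hc : (m + 4).choose (m + 3) = m + 4 := Nat.choose_succ_self_right (m + 3)
  have hh : harmonic (m + 4) = harmonic (m + 3) + ((m + 4 : ℕ) : ℚ)⁻¹ := harmonic_succ (m + 3)
  rw [show m + 4 - 1 = m + 3 by omega] at hA
  rw [hc] at hV
  rw [hh]
  simp only [Nat.choose_one_right, bernoulli_one, Nat.cast_zero, inv_zero, zero_mul, mul_zero,
    zero_add, add_zero, Nat.cast_one, inv_one] at hA hV
  have h3 : ((m + 3 : ℕ) : ℚ) ≠ 0 := by positivity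
  have h4 : ((m + 4 : ℕ) : ℚ) ≠ 0 := by positivity
  have h34 : ((m + 4 : ℕ) : ℚ) = ((m + 3 : ℕ) : ℚ) + 1 := by push_cast; ring
  rw [eq_div_iff h4]
  have hi : ((m + 3 : ℕ) : ℚ)⁻¹ * ((m + 3 : ℕ) : ℚ) = 1 := inv_mul_cancel₀ h3
  generalize ((m + 3 : ℕ) : ℚ)⁻¹ = t at *
  linear_combination hA - hV + (-((m + 4 : ℕ) : ℚ) * bernoulli (m + 3) * t) * h34
    - ((m + 4 : ℕ) : ℚ) * bernoulli (m + 3) * hi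
end

section
/- For integers n ≥ 1 and real numbers a, b > 0: ∑_{l=0}^{n} C(n,l)·((a)_l (b)_{n-l}/(a+b)_n)·E_l(x) E_{n-l}(x) = (4/(n+1)) B_{n+1}(x) - (2/(n+1))·∑_{l=0}^{n+1} C(n+1,l)·(((a)_l + (b)_l)/(a+b)_l)·E_l(0) B_{n+1-l}(x), as an identity of polynomials in x. -/
open Polynomial

/-- The `n`-th Euler polynomial, defined via Bernoulli polynomials by
`E_n(x) = (2^{n+1}/(n+1)) (B_{n+1}((x+1)/2) - B_{n+1}(x/2))`. -/
noncomputable def eulerPoly (n : ℕ) : Polynomial ℚ :=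
  Polynomial.C ((2 : ℚ) ^ (n + 1) / (n + 1)) *
    ((Polynomial.bernoulli (n + 1)).comp (Polynomial.C (1 / 2) * Polynomial.X + Polynomial.C (1 / 2))
      - (Polynomial.bernoulli (n + 1)).comp (Polynomial.C (1 / 2) * Polynomial.X))

set_option linter.unusedSectionVars false

section euler_aux
variable {A : Type*} [CommRing A] [IsDomain A] [Algebra ℚ A]

/-- generating function of the Bernoulli polynomials -/
noncomputable def genB (x : A) : PowerSeries A :=
  PowerSeries.mk fun n => aeval x ((1 / n.factorial : ℚ) • Polynomial.bernoulli n)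

/-- generating function of the Euler polynomials -/
noncomputable def genE (x : A) : PowerSeries A :=
  PowerSeries.mk fun n => aeval x ((1 / n.factorial : ℚ) • eulerPoly n)

/-- the series of `e^{yz}` -/
noncomputable def ee (y : A) : PowerSeries A := PowerSeries.rescale y (PowerSeries.exp A)

lemma ee_add (x y : A) : ee x * ee y = ee (x + y) := PowerSeries.exp_mul_exp_eq_exp_add x y

lemma ee_one : ee (1 : A) = PowerSeries.exp A := by simp [ee, PowerSeries.rescale_one]

lemma rescale_ee (x y : A) : PowerSeries.rescale x (ee y) = ee (y * x) := by
  rw [ee, PowerSeries.rescale_rescale, ee]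

lemma genB_spec (x : A) : genB x * (ee 1 - 1) = PowerSeries.X * ee x := by
  rw [ee_one]; exact Polynomial.bernoulli_generating_function x

lemma ee_sub_ne : (ee (1:A) - 1) ≠ 0 := by
  intro h
  have := congrArg (PowerSeries.coeff 1) h
  simp [ee_one, PowerSeries.coeff_exp, PowerSeries.coeff_one] at this

lemma ee_add_ne [CharZero A] (t : A) : (ee t + 1) ≠ 0 := by
  intro h
  have := congrArg (PowerSeries.coeff 0) h
  rw [map_add, ee, PowerSeries.coeff_rescale] at this
  simp [one_add_one_eq_two] at this

lemma two_alg : (2:A) = algebraMap ℚ A 2 := (map_ofNat (algebraMap ℚ A) 2).symm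

lemma X_mul_genE (x : A) : PowerSeries.X * genE x =
    PowerSeries.rescale (2:A) (genB (algebraMap ℚ A (1/2) * x + algebraMap ℚ A (1/2))
      - genB (algebraMap ℚ A (1/2) * x)) := by
  ext n
  cases n with
  | zero =>
    rw [PowerSeries.coeff_rescale, map_sub, genB, genB, PowerSeries.coeff_mk, PowerSeries.coeff_mk]
    simp
  | succ n =>
    rw [PowerSeries.coeff_succ_X_mul, PowerSeries.coeff_rescale, map_sub]
    simp only [genE, genB, PowerSeries.coeff_mk, map_smul, eulerPoly, map_mul, map_sub,
      aeval_comp, map_add, aeval_C, aeval_X]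
    have h2 : (2:A) ^ (n+1) = algebraMap ℚ A (2^(n+1)) := by
      rw [map_pow, two_alg]
    rw [h2, ← smul_sub]
    generalize (aeval (algebraMap ℚ A (1 / 2) * x + algebraMap ℚ A (1 / 2)))
      (Polynomial.bernoulli (n + 1)) = p
    generalize (aeval (algebraMap ℚ A (1 / 2) * x)) (Polynomial.bernoulli (n + 1)) = q
    rw [← Algebra.smul_def, ← Algebra.smul_def, smul_smul, smul_smul]
    congr 1
    rw [Nat.factorial_succ]
    push_cast
    have : (n.factorial : ℚ) ≠ 0 := by positivity
    field_simp

lemma genE_spec [CharZero A] (x : A) : genE x * (ee 1 + 1) = 2 * ee x := by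
  have h := X_mul_genE x
  have h2 : algebraMap ℚ A (1/2) * 2 = 1 := by
    rw [two_alg (A := A), ← map_mul]; norm_num
  have hB := fun y : A => congrArg (PowerSeries.rescale (2:A)) (genB_spec y)
  simp only [map_mul, map_sub, map_one, rescale_ee, PowerSeries.rescale_X] at hB
  have h3 := hB (algebraMap ℚ A (1/2) * x + algebraMap ℚ A (1/2))
  have h4 := hB (algebraMap ℚ A (1/2) * x)
  rw [show (algebraMap ℚ A (1/2) * x + algebraMap ℚ A (1/2)) * 2 = x + 1 by
    linear_combination (x + 1) * h2, ← ee_add] at h3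
  rw [show (algebraMap ℚ A (1/2) * x) * 2 = x by linear_combination x * h2] at h4
  have h5 : ee (1 * 2 : A) = ee 1 * ee 1 := by rw [ee_add]; norm_num
  rw [h5] at h3 h4
  rw [map_sub] at h
  have hC : (PowerSeries.C (2:A)) = 2 := map_ofNat _ 2
  rw [hC] at h3 h4
  apply mul_left_cancel₀ (PowerSeries.X_ne_zero (R := A))
  apply mul_right_cancel₀ (ee_sub_ne (A := A))
  linear_combination (ee 1 * ee 1 - 1) * h + h3 - h4

lemma gen_main [CharZero A] (x t s : A) (hts : t + s = 1) :
    PowerSeries.X * (PowerSeries.rescale t (genE x) * PowerSeries.rescale s (genE x)) =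
      genB x * (4 - 2 * (PowerSeries.rescale t (genE 0) + PowerSeries.rescale s (genE 0))) := by
  have hE := fun y r : A => congrArg (PowerSeries.rescale r) (genE_spec y)
  simp only [map_mul, map_add, map_one, rescale_ee, one_mul, map_ofNat] at hE
  have h1 := hE x t
  have h2 := hE x s
  have h3 := hE 0 t
  have h4 := hE 0 s
  have e0 : ee (0:A) = 1 := by simp [ee]
  rw [zero_mul, e0] at h3 h4
  have h5 := genB_spec x
  have h6 : ee t * ee s = ee 1 := by rw [ee_add, hts]
  have h7 : ee (x * t) * ee (x * s) = ee x := by rw [ee_add, ← mul_add, hts, mul_one]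
  apply mul_right_cancel₀ (ee_sub_ne (A := A))
  apply mul_right_cancel₀ (ee_add_ne t)
  apply mul_right_cancel₀ (ee_add_ne s)
  generalize PowerSeries.rescale t (genE x) = F1 at *
  generalize PowerSeries.rescale s (genE x) = F2 at *
  generalize PowerSeries.rescale t (genE 0) = F3 at *
  generalize PowerSeries.rescale s (genE 0) = F4 at *
  rw [← h7, ← h6] at h5
  rw [← h6]
  generalize ee t = u at *
  generalize ee s = v at *
  generalize ee (x*t) = p at *
  generalize ee (x*s) = q at *
  generalize genB x = G at *
  linear_combination PowerSeries.X * (u*v-1) * (F2 * (v+1) * h1 + 2 * p * h2)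
    - (u*v-1) * 4 * h5 + 2 * G * (u*v-1) * ((v+1) * h3 + (u+1) * h4)

end euler_aux

/-- The Beta moment functional on `ℝ[t]`. -/
noncomputable def betaL (a b : ℝ) : ℝ[X] →ₗ[ℝ] ℝ :=
  Polynomial.lsum fun l => ((ascPochhammer ℝ l).eval a / (ascPochhammer ℝ l).eval (a + b)) •
    (LinearMap.id : ℝ →ₗ[ℝ] ℝ)

lemma betaL_pow (a b : ℝ) (l : ℕ) : betaL a b (X ^ l) =
    (ascPochhammer ℝ l).eval a / (ascPochhammer ℝ l).eval (a + b) := by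
  rw [betaL, Polynomial.lsum_apply, ← Polynomial.monomial_one_right_eq_X_pow,
    Polynomial.sum_monomial_index] <;> simp

lemma betaL_mixed (a b : ℝ) (ha : 0 < a) (hb : 0 < b) (m l : ℕ) :
    betaL a b (X ^ l * (1 - X) ^ m) =
      (ascPochhammer ℝ l).eval a * (ascPochhammer ℝ m).eval b /
        (ascPochhammer ℝ (l + m)).eval (a + b) := by
  induction m generalizing l with
  | zero => simp [betaL_pow]
  | succ m ih =>
    have h : (X ^ l * (1 - X) ^ (m + 1) : ℝ[X]) = X ^ l * (1 - X) ^ m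
      - X ^ (l + 1) * (1 - X) ^ m := by ring
    rw [h, map_sub, ih, ih, show l + 1 + m = l + m + 1 by ring, ← add_assoc]
    simp only [ascPochhammer_succ_eval]
    have h1 : (ascPochhammer ℝ (l + m)).eval (a + b) ≠ 0 :=
      (ascPochhammer_pos _ _ (by positivity)).ne'
    have h2 : a + b + ((l + m : ℕ) : ℝ) ≠ 0 := by positivity
    push_cast at h2 ⊢
    field_simp
    ring

lemma betaL_C_mul (a b c : ℝ) (p : ℝ[X]) : betaL a b (C c * p) = c * betaL a b p := by
  rw [← Polynomial.smul_eq_C_mul, map_smul, smul_eq_mul]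

lemma coeff_genE_C (x : ℝ) (n : ℕ) : PowerSeries.coeff n (genE (C x)) =
    C ((1 / n.factorial : ℝ) * aeval x (eulerPoly n)) := by
  have h : ∀ p : ℚ[X], aeval (C x) p = C (aeval x p) := fun p => by
    have := Polynomial.aeval_algHom_apply (IsScalarTower.toAlgHom ℚ ℝ ℝ[X]) x p
    simpa using this
  rw [genE, PowerSeries.coeff_mk, h, map_smul, Rat.smul_def]
  push_cast
  rfl

lemma coeff_genB_C (x : ℝ) (n : ℕ) : PowerSeries.coeff n (genB (C x)) =
    C ((1 / n.factorial : ℝ) * aeval x (Polynomial.bernoulli n)) := by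
  have h : ∀ p : ℚ[X], aeval (C x) p = C (aeval x p) := fun p => by
    have := Polynomial.aeval_algHom_apply (IsScalarTower.toAlgHom ℚ ℝ ℝ[X]) x p
    simpa using this
  rw [genB, PowerSeries.coeff_mk, h, map_smul, Rat.smul_def]
  push_cast
  rfl

lemma main_coeff (n : ℕ) (a b : ℝ) (ha : 0 < a) (hb : 0 < b) (x : ℝ) :
    ∑ l ∈ Finset.range (n + 1), (1 / l.factorial : ℝ) * (1 / (n - l).factorial : ℝ) *
        ((ascPochhammer ℝ l).eval a * (ascPochhammer ℝ (n - l)).eval b /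
          (ascPochhammer ℝ n).eval (a + b)) *
        (aeval x (eulerPoly l)) * (aeval x (eulerPoly (n - l)))
      = 4 * ((1 / (n + 1).factorial : ℝ) * aeval x (Polynomial.bernoulli (n + 1)))
        - 2 * ∑ l ∈ Finset.range (n + 2),
            (1 / l.factorial : ℝ) * (1 / (n + 1 - l).factorial : ℝ) *
            (((ascPochhammer ℝ l).eval a + (ascPochhammer ℝ l).eval b) /
              (ascPochhammer ℝ l).eval (a + b)) *
            (aeval (0:ℝ) (eulerPoly l)) * aeval x (Polynomial.bernoulli (n + 1 - l)) := by
  have h := congrArg (PowerSeries.coeff (n + 1))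
    (gen_main (C x) (X : ℝ[X]) (1 - X) (by ring))
  rw [PowerSeries.coeff_succ_X_mul, mul_comm (genB _), sub_mul, map_sub, mul_assoc,
    ← map_ofNat (PowerSeries.C (R := ℝ[X])) 4, ← map_ofNat (PowerSeries.C (R := ℝ[X])) 2,
    PowerSeries.coeff_C_mul, PowerSeries.coeff_C_mul,
    PowerSeries.coeff_mul, PowerSeries.coeff_mul,
    Finset.Nat.sum_antidiagonal_eq_sum_range_succ_mk,
    Finset.Nat.sum_antidiagonal_eq_sum_range_succ_mk] at h
  simp only [map_add, PowerSeries.coeff_rescale, ← (Polynomial.C : ℝ →+* ℝ[X]).map_zero,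
    coeff_genE_C, coeff_genB_C] at h
  rw [← map_ofNat (Polynomial.C (R := ℝ)) 4, ← map_ofNat (Polynomial.C (R := ℝ)) 2] at h
  have h' := congrArg (betaL a b) h
  rw [map_sub, betaL_C_mul, betaL_C_mul, map_sum, map_sum] at h'
  have h1 : betaL a b 1 = 1 := by simpa using betaL_pow a b 0
  have hC : ∀ c : ℝ, betaL a b (C c) = c := fun c => by
    rw [← mul_one (C c), betaL_C_mul, h1, mul_one]
  rw [hC] at h'
  convert h' using 1
  · refine Finset.sum_congr rfl fun l hl => ?_
    have hl' : l + (n - l) = n := by have := Finset.mem_range.1 hl; omega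
    have := betaL_mixed a b ha hb (n - l) l
    rw [hl'] at this
    rw [mul_mul_mul_comm, ← C_mul, mul_comm _ (C _), betaL_C_mul, this]
    ring
  · congr 2
    refine Finset.sum_congr rfl fun l hl => ?_
    have e1 := betaL_pow a b l
    have e2 := betaL_mixed a b ha hb l 0
    simp only [pow_zero, one_mul, ascPochhammer_zero, eval_one, zero_add] at e2
    rw [← add_mul, mul_assoc (X ^ l + (1 - X) ^ l), ← C_mul, mul_comm _ (C _), betaL_C_mul, map_add,
      e1, e2]
    ring

theorem general_euler_convolution (n : ℕ) (hn : 1 ≤ n) (a b : ℝ)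
    (ha : 0 < a) (hb : 0 < b) (x : ℝ) :
    ∑ l ∈ Finset.range (n + 1), (n.choose l : ℝ) *
        ((ascPochhammer ℝ l).eval a * (ascPochhammer ℝ (n - l)).eval b /
          (ascPochhammer ℝ n).eval (a + b)) *
        (aeval x (eulerPoly l)) * (aeval x (eulerPoly (n - l)))
      = (4 / ((n : ℝ) + 1)) * aeval x (Polynomial.bernoulli (n + 1))
        - (2 / ((n : ℝ) + 1)) * ∑ l ∈ Finset.range (n + 2), ((n + 1).choose l : ℝ) *
            (((ascPochhammer ℝ l).eval a + (ascPochhammer ℝ l).eval b) /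
              (ascPochhammer ℝ l).eval (a + b)) *
            (((eulerPoly l).eval 0 : ℚ) : ℝ) * aeval x (Polynomial.bernoulli (n + 1 - l)) := by
  have h := congrArg (fun y => (n.factorial : ℝ) * y) (main_coeff n a b ha hb x)
  have h0 : ∀ p : ℚ[X], aeval (0:ℝ) p = ((p.eval 0 : ℚ) : ℝ) := fun p => by
    have := Polynomial.aeval_algebraMap_apply ℝ (0:ℚ) p
    simpa using this
  have hf : (n.factorial : ℝ) ≠ 0 := by positivity
  have hn1 : (n : ℝ) + 1 ≠ 0 := by positivity
  have hc : ∀ N l : ℕ, l ∈ Finset.range (N + 1) → (N.choose l : ℝ) =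
      N.factorial * ((1 / l.factorial : ℝ) * (1 / (N - l).factorial : ℝ)) := by
    intro N l hl
    rw [Nat.cast_choose ℝ (Nat.lt_succ_iff.1 (Finset.mem_range.1 hl))]
    field_simp
  have hfs : ((n + 1).factorial : ℝ) = (n + 1) * n.factorial := by
    rw [Nat.factorial_succ]; push_cast; ring
  simp only [h0] at h
  rw [mul_sub] at h
  convert h using 1
  · rw [Finset.mul_sum]
    refine Finset.sum_congr rfl fun l hl => ?_
    rw [hc n l hl]; ring
  · congr 1
    · rw [hfs]; field_simp
    · rw [Finset.mul_sum, Finset.mul_sum, Finset.mul_sum]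
      refine Finset.sum_congr rfl fun l hl => ?_
      rw [hc (n + 1) l hl, hfs]
      field_simp
end
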